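/- Let N ≥ 2, h_1, …, h_N > 0, σ² > 0, α > 0, P_max > 0, and R̄_1, …, R̄_{N−1} ≥ 0. Suppose p ≥ 0 satisfies Σ_{i=1}^{N} p_i = P_max and, for each i = 1, …, N−1, the rate constraint with equality: log₂((h_i²·a_i(p) + σ²/α)/(h_i²·a_{i+1}(p) + σ²/α)) = R̄_i. Then the sum rate equals Σ_{i=1}^{N} R_i(p) = log₂(1 + α·P_max·h_N²/(σ²·Π_{i=1}^{N−1} 2^{R̄_i}) − Σ_{i=1}^{N−1} h_N²·(2^{R̄_i} − 1)/(h_i²·Π_{l=i}^{N−1} 2^{R̄_l})) + Σ_{i=1}^{N−1} R̄_i. -/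

import Mathlib

open Finset

/-- Cumulative power `a_i = Σ_{l=i}^{N} p_l` (so `a_{N+1} = 0`). -/
noncomputable def cumPow (N : ℕ) (p : ℕ → ℝ) (i : ℕ) : ℝ := ∑ l ∈ Finset.Icc i N, p l

/-- Per-user SIC rate `R_i(p) = log₂((hᵢ²·aᵢ(p) + c)/(hᵢ²·a_{i+1}(p) + c))`, `c = σ²/α`. -/
noncomputable def rate (N : ℕ) (h : ℕ → ℝ) (c : ℝ) (p : ℕ → ℝ) (i : ℕ) : ℝ :=
  Real.logb 2 (((h i) ^ 2 * cumPow N p i + c) / ((h i) ^ 2 * cumPow N p (i + 1) + c))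

/-- Closed form of the solution of the affine recurrence `a_{m+1} = (a_m - b_m) / g_m`. -/
theorem affine_recurrence_closed_form {a b g : ℕ → ℝ} {M : ℕ}
    (hrec : ∀ i ∈ Finset.Icc 1 M, a (i + 1) = (a i - b i) / g i) :
    a (M + 1) = a 1 / ∏ i ∈ Finset.Icc 1 M, g i -
      ∑ i ∈ Finset.Icc 1 M, b i / ∏ l ∈ Finset.Icc i M, g l := by
  induction M with
  | zero => simp
  | succ M ih =>
    have hsum : ∑ i ∈ Finset.Icc 1 M, b i / ∏ l ∈ Finset.Icc i (M + 1), g l =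
        (∑ i ∈ Finset.Icc 1 M, b i / ∏ l ∈ Finset.Icc i M, g l) / g (M + 1) := by
      rw [Finset.sum_div]
      refine Finset.sum_congr rfl fun i hi => ?_
      have hiM := (Finset.mem_Icc.mp hi).2
      rw [Finset.prod_Icc_succ_top (by lia), div_div]
    rw [hrec (M + 1) (by simp),
      ih fun i hi => hrec i (Finset.Icc_subset_Icc_right M.le_succ hi),
      Finset.sum_Icc_succ_top (by lia), Finset.prod_Icc_succ_top (by lia), hsum,
      Finset.Icc_self, Finset.prod_singleton, ← div_div]
    ring

theorem cumPow_nonneg {N : ℕ} {p : ℕ → ℝ} (hp : ∀ i ∈ Finset.Icc 1 N, 0 ≤ p i)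
    {i : ℕ} (hi : 1 ≤ i) : 0 ≤ cumPow N p i :=
  Finset.sum_nonneg fun l hl => hp l (Finset.Icc_subset_Icc_left hi hl)

/-- A prescribed rate of user `i` determines `a_{i+1}` from `a_i`. -/
theorem cumPow_succ_eq_of_rate_eq {N : ℕ} {h p : ℕ → ℝ} {c R : ℝ} {i : ℕ}
    (hc : 0 < c) (hh : 0 < h i) (hp : ∀ i ∈ Finset.Icc 1 N, 0 ≤ p i) (hi : 1 ≤ i)
    (hrate : rate N h c p i = R) :
    cumPow N p (i + 1) =
      (cumPow N p i - c * ((2 : ℝ) ^ R - 1) / (h i) ^ 2) / (2 : ℝ) ^ R := by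
  have ha := cumPow_nonneg hp hi
  have hb := cumPow_nonneg hp (Nat.le_add_left 1 i)
  have hden : 0 < (h i) ^ 2 * cumPow N p (i + 1) + c := by positivity
  have hpow : (2 : ℝ) ^ R =
      ((h i) ^ 2 * cumPow N p i + c) / ((h i) ^ 2 * cumPow N p (i + 1) + c) := by
    rw [← hrate, rate, Real.rpow_logb (by norm_num) (by norm_num) (by positivity)]
  have hg : (0 : ℝ) < 2 ^ R := by positivity
  rw [eq_div_iff hden.ne'] at hpow
  field_simp
  linarith

/-- if full power is used and the rate constraints of the first `N−1` users
hold with equality, the sum rate equals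
`log₂(1 + α·P_max·h_N²/(σ²·Π_{i<N} 2^{R̄ᵢ}) − Σ_{i<N} h_N²·(2^{R̄ᵢ}−1)/(hᵢ²·Π_{l=i}^{N−1} 2^{R̄_l})) + Σ_{i<N} R̄ᵢ`. -/
theorem sum_rate_closed_form_at_full_power
    (N : ℕ) (hN : 2 ≤ N) (h Rbar p : ℕ → ℝ) (σ2 α Pmax : ℝ)
    (hσ : 0 < σ2) (hα : 0 < α) (hP : 0 < Pmax)
    (hh : ∀ i ∈ Finset.Icc 1 N, 0 < h i)
    (hR : ∀ i ∈ Finset.Icc 1 (N - 1), 0 ≤ Rbar i)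
    (hp : ∀ i ∈ Finset.Icc 1 N, 0 ≤ p i)
    (hfull : ∑ i ∈ Finset.Icc 1 N, p i = Pmax)
    (htight : ∀ i ∈ Finset.Icc 1 (N - 1), rate N h (σ2 / α) p i = Rbar i) :
    ∑ i ∈ Finset.Icc 1 N, rate N h (σ2 / α) p i =
      Real.logb 2 (1 + α * Pmax * (h N) ^ 2 /
          (σ2 * ∏ i ∈ Finset.Icc 1 (N - 1), (2 : ℝ) ^ (Rbar i)) -
        ∑ i ∈ Finset.Icc 1 (N - 1), (h N) ^ 2 * ((2 : ℝ) ^ (Rbar i) - 1) /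
          ((h i) ^ 2 * ∏ l ∈ Finset.Icc i (N - 1), (2 : ℝ) ^ (Rbar l))) +
      ∑ i ∈ Finset.Icc 1 (N - 1), Rbar i := by
  obtain ⟨M, rfl⟩ : ∃ M, N = M + 1 := ⟨N - 1, by lia⟩
  simp only [Nat.add_sub_cancel] at hR htight ⊢
  have hc : 0 < σ2 / α := div_pos hσ hα
  have hcum := affine_recurrence_closed_form (a := cumPow (M + 1) p)
    (b := fun i => σ2 / α * ((2 : ℝ) ^ Rbar i - 1) / (h i) ^ 2)
    (g := fun i => (2 : ℝ) ^ Rbar i) (M := M) fun i hi =>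
      cumPow_succ_eq_of_rate_eq hc (hh i (Finset.Icc_subset_Icc_right M.le_succ hi)) hp
        (Finset.mem_Icc.mp hi).1 (htight i hi)
  have hone : cumPow (M + 1) p 1 = Pmax := hfull
  have hlast : cumPow (M + 1) p (M + 1 + 1) = 0 := by simp [cumPow]
  rw [Finset.sum_Icc_succ_top (by lia), Finset.sum_congr rfl htight, add_comm]
  congr 1
  rw [rate, hlast, hcum, hone]
  congr 1
  have hsum : ∑ i ∈ Finset.Icc 1 M, (h (M + 1)) ^ 2 * ((2 : ℝ) ^ Rbar i - 1) /
        ((h i) ^ 2 * ∏ l ∈ Finset.Icc i M, (2 : ℝ) ^ Rbar l) =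
      (h (M + 1)) ^ 2 * (α / σ2) * ∑ i ∈ Finset.Icc 1 M,
        σ2 / α * ((2 : ℝ) ^ Rbar i - 1) / (h i) ^ 2 /
          ∏ l ∈ Finset.Icc i M, (2 : ℝ) ^ Rbar l := by
    rw [Finset.mul_sum]
    refine Finset.sum_congr rfl fun i _ => ?_
    rw [div_div]
    field_simp
  have hprod : (0 : ℝ) < ∏ i ∈ Finset.Icc 1 M, (2 : ℝ) ^ Rbar i :=
    Finset.prod_pos fun i _ => by positivity
  rw [hsum]
  field_simp
  ring
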